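/- arXiv:math/0303001 — 5 statements merged into one kernel-verified Lean document; each statement's English description precedes it below -/
import Mathlib

section
/- Let F be a field, let H1 and H2 be groups, and let τ1: H1 → Aut_F(W1) and τ2: H2 → Aut_F(W2) be finite-dimensional F-linear representations. Set F1 = End_{H1}(W1) (the centralizer of τ1(H1) in End_F(W1)) and F2 = End_{H2}(W2) (the centralizer of τ2(H2) in End_F(W2)). Assume that the F-algebras F1 and F2 are fields that are linearly disjoint over F, i.e., the F-algebra F1 ⊗_F F2 is a field. Then the centralizer End_{H1×H2}(Hom_F(W1,W2)) of the group H = H1 × H2 in End_F(Hom_F(W1,W2)), for the representation in which (h1,h2) sends φ to τ2(h2) ∘ φ ∘ τ1(h1)^{-1}, is a field. -/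
open TensorProduct

set_option synthInstance.maxHeartbeats 1000000
set_option maxHeartbeats 1000000

/-- The centralizer `End_H(W)` of a linear representation `τ : H →* Aut_F(W)`
inside `End_F(W)`. -/
def reprCentralizer (F : Type*) [Field F] {H : Type*} [Group H]
    {W : Type*} [AddCommGroup W] [Module F W] (τ : H →* (W ≃ₗ[F] W)) :
    Subalgebra F (Module.End F W) :=
  Subalgebra.centralizer F (Set.range fun h : H => ((τ h : W →ₗ[F] W) : Module.End F W))

/-- Left/right multiplication: `a ⊗ b ↦ (φ ↦ b ∘ φ ∘ a)`. -/
noncomputable def sandwich (F : Type*) [Field F] (W1 W2 : Type*)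
    [AddCommGroup W1] [Module F W1] [AddCommGroup W2] [Module F W2] :
    ((Module.End F W1)ᵐᵒᵖ ⊗[F] (Module.End F W2)) →ₐ[F] Module.End F (W1 →ₗ[F] W2) :=
  Algebra.TensorProduct.lift
    (AlgHom.ofLinearMap
      { toFun := fun a => LinearMap.lcomp F W2 (MulOpposite.unop a)
        map_add' := fun a b => by ext; simp
        map_smul' := fun a b => by ext; simp }
      (by ext; simp) (fun a b => by ext; simp))
    (AlgHom.ofLinearMap
      { toFun := fun b => LinearMap.llcomp F W1 W2 W2 b
        map_add' := fun a b => by ext; simp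
        map_smul' := fun a b => by ext; simp }
      (by ext; simp) (fun a b => by ext; simp))
    (fun a b => (commute_iff_eq _ _).2 (by ext; simp))

theorem sandwich_tmul (F : Type*) [Field F] (W1 W2 : Type*)
    [AddCommGroup W1] [Module F W1] [AddCommGroup W2] [Module F W2]
    (a : (Module.End F W1)ᵐᵒᵖ) (b : Module.End F W2) (φ : W1 →ₗ[F] W2) :
    sandwich F W1 W2 (a ⊗ₜ b) φ = b ∘ₗ φ ∘ₗ a.unop := by
  exact LinearMap.congr_fun (Algebra.TensorProduct.lift_tmul _ _ _ a b) φ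

theorem sandwich_injective (F : Type*) [Field F] (W1 W2 : Type*)
    [AddCommGroup W1] [Module F W1] [AddCommGroup W2] [Module F W2] :
    Function.Injective (sandwich F W1 W2) := by
  rw [injective_iff_map_eq_zero]
  intro t ht
  let B := Module.Basis.ofVectorSpace F (Module.End F W2)
  obtain ⟨c, rfl⟩ := TensorProduct.eq_repr_basis_right B t
  have key : ∀ i, c i = 0 := by
    intro i
    apply MulOpposite.unop_injective
    ext x
    rw [MulOpposite.unop_zero, LinearMap.zero_apply, ← Module.forall_dual_apply_eq_zero_iff F]
    intro f
    have h2 : c.sum (fun i a => f (a.unop x) • B i) = 0 := by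
      ext w
      have := LinearMap.congr_fun (LinearMap.congr_fun ht (f.smulRight w)) x
      simpa [Finsupp.sum, sandwich_tmul, LinearMap.sum_apply] using this
    by_cases hi : i ∈ c.support
    · exact linearIndependent_iff'.1 B.linearIndependent c.support
        (fun i => f ((c i).unop x)) h2 i hi
    · simp [Finsupp.notMem_support_iff.1 hi]
  have : c = 0 := Finsupp.ext key
  simp [this]

theorem sandwich_bijective (F : Type*) [Field F] (W1 W2 : Type*)
    [AddCommGroup W1] [Module F W1] [AddCommGroup W2] [Module F W2]
    [FiniteDimensional F W1] [FiniteDimensional F W2] :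
    Function.Bijective (sandwich F W1 W2) := by
  refine ⟨sandwich_injective F W1 W2, ?_⟩
  have : FiniteDimensional F (Module.End F W1)ᵐᵒᵖ :=
    Module.Finite.equiv (MulOpposite.opLinearEquiv F)
  have h : Module.finrank F ((Module.End F W1)ᵐᵒᵖ ⊗[F] (Module.End F W2)) =
      Module.finrank F (Module.End F (W1 →ₗ[F] W2)) := by
    rw [Module.finrank_tensorProduct, ← (MulOpposite.opLinearEquiv F).finrank_eq]
    simp only [Module.finrank_linearMap]
    ring
  exact (LinearMap.injective_iff_surjective_of_finrank_eq_finrank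
    (f := (sandwich F W1 W2).toLinearMap) h).1 (sandwich_injective F W1 W2)

theorem isField_range {F K B : Type*} [Field F] [Semiring K] [Algebra F K] [Semiring B] [Algebra F B]
    [Nontrivial B] (hK : IsField K) (g : K →ₐ[F] B) : IsField g.range := by
  refine ⟨⟨0, 1, zero_ne_one⟩, ?_, ?_⟩
  · rintro ⟨_, x, rfl⟩ ⟨_, y, rfl⟩
    apply Subtype.ext
    change g x * g y = g y * g x
    rw [← map_mul, hK.mul_comm, map_mul]
  · rintro ⟨_, x, rfl⟩ hx
    have hx0 : x ≠ 0 := by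
      rintro rfl
      exact hx (Subtype.ext (map_zero g))
    obtain ⟨y, hy⟩ := hK.mul_inv_cancel hx0
    refine ⟨⟨_, y, rfl⟩, Subtype.ext ?_⟩
    change g x * g y = 1
    rw [← map_mul, hy, map_one]

theorem centralizer_tensor {F A B : Type*} [Field F] [Ring A] [Algebra F A] [Ring B] [Algebra F B]
    (S : Set A) (T : Set B) (t : A ⊗[F] B)
    (hS : ∀ s ∈ S, (s ⊗ₜ[F] (1 : B)) * t = t * (s ⊗ₜ[F] (1 : B)))
    (hT : ∀ s ∈ T, ((1 : A) ⊗ₜ[F] s) * t = t * ((1 : A) ⊗ₜ[F] s)) :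
    t ∈ (Algebra.TensorProduct.map (Subalgebra.centralizer F S).val
      (Subalgebra.centralizer F T).val).range := by
  have h1 : t ∈ Subalgebra.centralizer F
      (Set.image (Algebra.TensorProduct.includeRight : B →ₐ[F] A ⊗[F] B) T) := by
    rw [Subalgebra.mem_centralizer_iff]
    rintro _ ⟨s, hs, rfl⟩
    exact hT s hs
  rw [Subalgebra.centralizer_coe_image_includeRight_eq_center_tensorProduct] at h1
  obtain ⟨u, rfl⟩ := h1
  let j : A ⊗[F] (Subalgebra.centralizer F T) →ₐ[F] A ⊗[F] B :=
    Algebra.TensorProduct.map (AlgHom.id F A) (Subalgebra.centralizer F T).val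
  have hj : Function.Injective j :=
    Module.Flat.lTensor_preserves_injective_linearMap (M := A)
      (Subalgebra.centralizer F T).val.toLinearMap Subtype.val_injective
  have h2 : u ∈ Subalgebra.centralizer F
      (Set.image (Algebra.TensorProduct.includeLeft :
        A →ₐ[F] A ⊗[F] (Subalgebra.centralizer F T)) S) := by
    rw [Subalgebra.mem_centralizer_iff]
    rintro _ ⟨s, hs, rfl⟩
    apply hj
    rw [map_mul, map_mul]
    simpa [j] using hS s hs
  rw [Subalgebra.centralizer_coe_image_includeLeft_eq_center_tensorProduct] at h2
  obtain ⟨v, rfl⟩ := h2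
  refine ⟨v, ?_⟩
  change _ = j.comp (Algebra.TensorProduct.map _ _) v
  rw [← Algebra.TensorProduct.map_comp]
  rfl

/-- **Lemma 5.1 (irrprod)**: if `F1 = End_{H1}(W1)` and `F2 = End_{H2}(W2)` are fields
that are linearly disjoint over `F` (i.e. `F1 ⊗_F F2` is a field), then the centralizer
of `H1 × H2` in `End_F(Hom_F(W1, W2))` is a field, where `(h1, h2)` acts on `φ` by
`τ2 h2 ∘ φ ∘ (τ1 h1)⁻¹`. -/
theorem centralizer_of_prod_isField
    (F : Type*) [Field F] {H1 H2 : Type*} [Group H1] [Group H2]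
    {W1 W2 : Type*} [AddCommGroup W1] [Module F W1] [AddCommGroup W2] [Module F W2]
    [FiniteDimensional F W1] [FiniteDimensional F W2]
    (τ1 : H1 →* (W1 ≃ₗ[F] W1)) (τ2 : H2 →* (W2 ≃ₗ[F] W2))
    (hF1 : IsField (reprCentralizer F τ1))
    (hF2 : IsField (reprCentralizer F τ2))
    (hdisj : IsField (TensorProduct F (reprCentralizer F τ1) (reprCentralizer F τ2))) :
    IsField (Subalgebra.centralizer F
      (Set.range fun p : H1 × H2 =>
        ((LinearEquiv.arrowCongr (τ1 p.1) (τ2 p.2) :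
            (W1 →ₗ[F] W2) ≃ₗ[F] (W1 →ₗ[F] W2)) :
          Module.End F (W1 →ₗ[F] W2)))) := by
  have hmc : ∀ a b : reprCentralizer F τ1, a * b = b * a := hF1.mul_comm
  let ι : reprCentralizer F τ1 →ₐ[F] (Module.End F W1)ᵐᵒᵖ :=
    AlgHom.ofLinearMap
      ((MulOpposite.opLinearEquiv F).toLinearMap ∘ₗ (reprCentralizer F τ1).val.toLinearMap)
      rfl (fun a b => by rw [hmc]; rfl)
  let κ := (reprCentralizer F τ2).val
  let S : Set (Module.End F W1)ᵐᵒᵖ :=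
    Set.range fun h : H1 => MulOpposite.op ((τ1 h : W1 →ₗ[F] W1) : Module.End F W1)
  let T : Set (Module.End F W2) :=
    Set.range fun h : H2 => ((τ2 h : W2 →ₗ[F] W2) : Module.End F W2)
  let g := (sandwich F W1 W2).comp (Algebra.TensorProduct.map ι κ)
  have n1 : Nontrivial W1 := by
    by_contra hW
    rw [not_nontrivial_iff_subsingleton] at hW
    obtain ⟨x, y, hxy⟩ := hF1.exists_pair_ne
    exact hxy (Subtype.ext (LinearMap.ext fun _ => Subsingleton.elim _ _))
  have n2 : Nontrivial W2 := by
    by_contra hW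
    rw [not_nontrivial_iff_subsingleton] at hW
    obtain ⟨x, y, hxy⟩ := hF2.exists_pair_ne
    exact hxy (Subtype.ext (LinearMap.ext fun _ => Subsingleton.elim _ _))
  have hact : ∀ p : H1 × H2, ((LinearEquiv.arrowCongr (τ1 p.1) (τ2 p.2) :
            (W1 →ₗ[F] W2) ≃ₗ[F] (W1 →ₗ[F] W2)) : Module.End F (W1 →ₗ[F] W2)) =
      sandwich F W1 W2 (MulOpposite.op ((τ1 p.1⁻¹ : W1 →ₗ[F] W1) : Module.End F W1) ⊗ₜ
        ((τ2 p.2 : W2 →ₗ[F] W2) : Module.End F W2)) := by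
    intro p
    ext φ x
    rw [sandwich_tmul, map_inv]
    rfl
  have hιS : ι.range = Subalgebra.centralizer F S := by
    ext x
    rw [Subalgebra.mem_centralizer_iff]
    constructor
    · rintro ⟨a, rfl⟩ _ ⟨h, rfl⟩
      exact congrArg MulOpposite.op (a.2 _ ⟨h, rfl⟩).symm
    · intro hx
      refine ⟨⟨x.unop, ?_⟩, rfl⟩
      rintro _ ⟨h, rfl⟩
      exact (congrArg MulOpposite.unop (hx _ ⟨h, rfl⟩)).symm
  have hrange : (Algebra.TensorProduct.map ι κ).range =
      (Algebra.TensorProduct.map (Subalgebra.centralizer F S).val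
        (Subalgebra.centralizer F T).val).range := by
    rw [Algebra.TensorProduct.map_range, Algebra.TensorProduct.map_range,
      AlgHom.range_comp, AlgHom.range_comp, AlgHom.range_comp, AlgHom.range_comp, hιS,
      Subalgebra.range_val, Subalgebra.range_val, Subalgebra.range_val]
    rfl
  have main : Subalgebra.centralizer F
      (Set.range fun p : H1 × H2 =>
        ((LinearEquiv.arrowCongr (τ1 p.1) (τ2 p.2) :
            (W1 →ₗ[F] W2) ≃ₗ[F] (W1 →ₗ[F] W2)) :
          Module.End F (W1 →ₗ[F] W2))) = g.range := by
    have hb := sandwich_bijective F W1 W2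
    ext X
    rw [Subalgebra.mem_centralizer_iff]
    constructor
    · intro hX
      obtain ⟨t, rfl⟩ := hb.2 X
      have ht : t ∈ (Algebra.TensorProduct.map ι κ).range := by
        rw [hrange]
        apply centralizer_tensor
        · rintro _ ⟨h, rfl⟩
          have := hX _ ⟨(h⁻¹, 1), hact (h⁻¹, 1)⟩
          rw [← map_mul, ← map_mul] at this
          have := hb.1 this
          rw [inv_inv, map_one] at this
          exact this
        · rintro _ ⟨h, rfl⟩
          have := hX _ ⟨(1, h), hact (1, h)⟩
          rw [← map_mul, ← map_mul] at this
          have := hb.1 this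
          rw [inv_one, map_one] at this
          exact this
      obtain ⟨u, rfl⟩ := ht
      exact ⟨u, rfl⟩
    · rintro ⟨u, rfl⟩ _ ⟨p, rfl⟩
      dsimp only
      rw [hact]
      change _ * (sandwich F W1 W2) (Algebra.TensorProduct.map ι κ u) =
        (sandwich F W1 W2) (Algebra.TensorProduct.map ι κ u) * _
      rw [← map_mul, ← map_mul]
      congr 1
      induction u with
      | zero => simp
      | add x y hx hy => rw [map_add, mul_add, add_mul, hx, hy]
      | tmul a b =>
        rw [Algebra.TensorProduct.map_tmul, Algebra.TensorProduct.tmul_mul_tmul,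
          Algebra.TensorProduct.tmul_mul_tmul]
        congr 1
        · exact congrArg MulOpposite.op (a.2 _ ⟨p.1⁻¹, rfl⟩).symm
        · exact b.2 _ ⟨p.2, rfl⟩
  rw [main]
  exact isField_range hdisj g
end

section
/- Let Q be a field of characteristic zero, V a finite-dimensional Q-vector space, G a group, and τ: G → Aut_Q(V) a completely reducible Q-linear representation of G in V. Let L be an overfield of Q and let i: L → End_Q(V) be an embedding of Q-algebras sending 1 to the identity automorphism of V, such that the image i(L) commutes with τ(G). Regard V as an L-vector space via i; then the resulting L-linear representation of G in V is also completely reducible. -/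
set_option synthInstance.maxHeartbeats 1000000
set_option maxHeartbeats 1000000

open scoped TensorProduct

/-- **Lemma 5.3 (ext)**: Let `Q` be a field of characteristic zero, `V` a finite-dimensional
`Q`-vector space and `τ : G → Aut_Q(V)` a completely reducible `Q`-linear representation
(every `G`-stable `Q`-subspace has a `G`-stable complement). Let `L ⊇ Q` be an overfield and
`i : L → End_Q(V)` an embedding of `Q`-algebras (so `i 1 = id_V`) whose image commutes with
`τ(G)`. Regarding `V` as an `L`-vector space via `i` (whose subspaces are exactly the
`Q`-subspaces stable under `i(L)`), the resulting `L`-linear representation of `G` is also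
completely reducible: every `G`-stable and `i(L)`-stable subspace has a `G`-stable and
`i(L)`-stable complement. -/
theorem completelyReducible_over_extension
    (Q : Type*) [Field Q] [CharZero Q]
    (V : Type*) [AddCommGroup V] [Module Q V] [FiniteDimensional Q V]
    {G : Type*} [Group G] (τ : G →* (V ≃ₗ[Q] V))
    (L : Type*) [Field L] [Algebra Q L]
    (i : L →ₐ[Q] Module.End Q V) (hinj : Function.Injective i)
    (hcomm : ∀ (l : L) (g : G), Commute (i l) ((τ g : V →ₗ[Q] V) : Module.End Q V))
    (hcr : ∀ U : Submodule Q V, (∀ g, ∀ x ∈ U, τ g x ∈ U) →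
      ∃ U' : Submodule Q V, (∀ g, ∀ x ∈ U', τ g x ∈ U') ∧ U ⊓ U' = ⊥ ∧ U ⊔ U' = ⊤) :
    ∀ U : Submodule Q V, (∀ g, ∀ x ∈ U, τ g x ∈ U) → (∀ l : L, ∀ x ∈ U, i l x ∈ U) →
      ∃ U' : Submodule Q V, (∀ g, ∀ x ∈ U', τ g x ∈ U') ∧
        (∀ l : L, ∀ x ∈ U', i l x ∈ U') ∧ U ⊓ U' = ⊥ ∧ U ⊔ U' = ⊤ := by
  intro U hUG hUL
  obtain ⟨W, hWG, hd, hs⟩ := hcr U hUG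
  have hc : IsCompl U W := ⟨disjoint_iff.2 hd, codisjoint_iff.2 hs⟩
  have : FiniteDimensional Q L := FiniteDimensional.of_injective i.toLinearMap hinj
  have : Algebra.FormallyUnramified Q L := Algebra.FormallyUnramified.of_isSeparable Q L
  obtain ⟨t, ht, ht1⟩ := (Algebra.FormallyUnramified.iff_exists_tensorProduct (R := Q) (S := L)).1
    inferInstance
  obtain ⟨p, hpU, hpid, hpW⟩ : ∃ p : Module.End Q V, (∀ x, p x ∈ U) ∧ (∀ x ∈ U, p x = x) ∧
      (∀ x ∈ W, p x = 0) := by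
    refine ⟨U.projection W hc, fun x => Submodule.projection_apply_mem hc x,
      fun x hx => Submodule.projection_apply_of_mem_left hc hx, fun x hx => ?_⟩
    rw [Submodule.projection_apply, (Submodule.projectionOnto_apply_eq_zero_iff hc).2 hx]
    rfl
  have hpG : ∀ g x, p (τ g x) = τ g (p x) := by
    intro g x
    have hx : x ∈ U ⊔ W := hs ▸ Submodule.mem_top
    obtain ⟨u, hu, w, hw, rfl⟩ := Submodule.mem_sup.1 hx
    simp [hpid u hu, hpW w hw, hpid _ (hUG g u hu), hpW _ (hWG g w hw)]
  have hiG : ∀ l g x, i l (τ g x) = τ g (i l x) := fun l g x =>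
    LinearMap.congr_fun (hcomm l g).eq x
  obtain ⟨Φ, hΦ⟩ : ∃ Φ : TensorProduct Q L L →ₗ[Q] Module.End Q V,
      ∀ a b, Φ (a ⊗ₜ[Q] b) = i a * p * i b :=
    ⟨TensorProduct.lift (LinearMap.mk₂ Q (fun a b => i a * p * i b)
      (by intros; simp [add_mul]) (by intros; simp)
      (by intros; simp [mul_add]) (by intros; simp)), by intros; simp⟩
  have h1 : ∀ (s : L) (z : TensorProduct Q L L), Φ ((s ⊗ₜ[Q] 1) * z) = i s * Φ z := by
    intro s z
    induction z with
    | zero => simp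
    | add x y hx hy => simp [mul_add, hx, hy]
    | tmul a b => simp [hΦ, mul_assoc]
  have h2 : ∀ (s : L) (z : TensorProduct Q L L), Φ (((1 : L) ⊗ₜ[Q] s) * z) = Φ z * i s := by
    intro s z
    induction z with
    | zero => simp
    | add x y hx hy => simp [mul_add, add_mul, hx, hy]
    | tmul a b => rw [Algebra.TensorProduct.tmul_mul_tmul, mul_comm s b]; simp [hΦ, mul_assoc]
  have h3 : ∀ (z : TensorProduct Q L L) (x : V), Φ z x ∈ U := by
    intro z x
    induction z with
    | zero => simp
    | add a b ha hb => simpa using U.add_mem ha hb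
    | tmul a b => rw [hΦ]; exact hUL a _ (hpU _)
  have h4 : ∀ (z : TensorProduct Q L L) (x : V), x ∈ U →
      Φ z x = i (LinearMap.mul' Q L z) x := by
    intro z x hx
    induction z with
    | zero => simp
    | add a b ha hb => simp [ha, hb]
    | tmul a b => simp [hΦ, hpid _ (hUL b x hx)]
  have h5 : ∀ (z : TensorProduct Q L L) (g : G) (x : V), Φ z (τ g x) = τ g (Φ z x) := by
    intro z g x
    induction z with
    | zero => simp
    | add a b ha hb => simp [ha, hb]
    | tmul a b => simp [hΦ, hiG, hpG]
  have h6 : ∀ (s : L) (x : V), Φ t (i s x) = i s (Φ t x) := by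
    intro s x
    have h := ht s
    rw [sub_mul, sub_eq_zero] at h
    have h' := congrArg Φ h
    rw [h1, h2] at h'
    first
      | exact LinearMap.congr_fun h' x
      | exact (LinearMap.congr_fun h' x).symm
  have h7 : ∀ x ∈ U, Φ t x = x := by
    intro x hx
    have h8 : LinearMap.mul' Q L t = 1 := ht1
    rw [h4 t x hx, h8]; simp
  refine ⟨LinearMap.ker (Φ t), ?_, ?_, ?_, ?_⟩
  · intro g x hx
    rw [LinearMap.mem_ker] at hx ⊢
    rw [h5, hx, map_zero]
  · intro l x hx
    rw [LinearMap.mem_ker] at hx ⊢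
    rw [h6, hx, map_zero]
  · rw [eq_bot_iff]
    rintro x ⟨hx, hx'⟩
    have h9 : Φ t x = 0 := hx'
    rw [h7 x hx] at h9
    simpa using h9
  · rw [eq_top_iff]
    intro x _
    refine Submodule.mem_sup.2 ⟨Φ t x, h3 t x, x - Φ t x, ?_, by abel⟩
    rw [LinearMap.mem_ker, map_sub, h7 _ (h3 t x), sub_self]
end

section
/- Let ℓ be an odd prime and R a finite set of cardinality n ≥ 4 with ℓ not dividing n. Let G ≤ Perm(R) be a permutation group acting doubly transitively on R. Then the centralizer of G in End_{F_ℓ}((F_ℓ^R)^{00}) consists exactly of the scalar operators; that is, End_G((F_ℓ^R)^{00}) = F_ℓ. -/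
open Finset

/-- The hyperplane `(F_ℓ^R)^0` of functions `ψ : R → F_ℓ` with `∑ ψ(r) = 0`. -/
def zeroSum (ℓ : ℕ) (R : Type*) [Fintype R] : Submodule (ZMod ℓ) (R → ZMod ℓ) where
  carrier := {ψ | ∑ r, ψ r = 0}
  add_mem' := by
    intro a b ha hb
    simp only [Set.mem_setOf_eq, Pi.add_apply] at *
    simp [Finset.sum_add_distrib, ha, hb]
  zero_mem' := by simp
  smul_mem' := by
    intro c ψ hψ
    simp only [Set.mem_setOf_eq, Pi.smul_apply, smul_eq_mul] at *
    simp [← Finset.mul_sum, hψ]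

theorem mem_zeroSum (ℓ : ℕ) (R : Type*) [Fintype R] (ψ : R → ZMod ℓ) :
    ψ ∈ zeroSum ℓ R ↔ ∑ r, ψ r = 0 := Iff.rfl

/-- The natural action of a permutation `σ` on `(F_ℓ^R)^0`, `ψ ↦ ψ ∘ σ⁻¹`. -/
def permSub {ℓ : ℕ} {R : Type*} [Fintype R] (σ : Equiv.Perm R) :
    Module.End (ZMod ℓ) (zeroSum ℓ R) :=
  (LinearMap.funLeft (ZMod ℓ) (ZMod ℓ) σ.symm).restrict fun ψ hψ => by
    rw [mem_zeroSum] at hψ ⊢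
    simpa [LinearMap.funLeft_apply] using (Equiv.sum_comp σ.symm ψ).trans hψ

/-- The line `F_ℓ·1` of constant functions in `F_ℓ^R`. -/
def constLine (ℓ : ℕ) (R : Type*) : Submodule (ZMod ℓ) (R → ZMod ℓ) :=
  Submodule.span (ZMod ℓ) {fun _ => (1 : ZMod ℓ)}

/-- The line of constant functions, viewed inside `(F_ℓ^R)^0` (useful when `ℓ ∣ #R`). -/
def constInZeroSum (ℓ : ℕ) (R : Type*) [Fintype R] : Submodule (ZMod ℓ) (zeroSum ℓ R) :=
  Submodule.comap (zeroSum ℓ R).subtype (constLine ℓ R)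

/-- The induced action of a permutation `σ` on the heart `(F_ℓ^R)^{00} = (F_ℓ^R)^0/(F_ℓ·1)`
in the case `ℓ ∣ #R`. -/
def permHeart {ℓ : ℕ} {R : Type*} [Fintype R] (σ : Equiv.Perm R) :
    Module.End (ZMod ℓ) (zeroSum ℓ R ⧸ constInZeroSum ℓ R) :=
  Submodule.mapQ (constInZeroSum ℓ R) (constInZeroSum ℓ R) (permSub σ) (by
    intro x hx
    simp only [constInZeroSum, Submodule.mem_comap, Submodule.subtype_apply,
      constLine, Submodule.mem_span_singleton] at hx ⊢
    obtain ⟨c, hc⟩ := hx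
    refine ⟨c, ?_⟩
    funext r
    have hval : ((permSub σ x : zeroSum ℓ R) : R → ZMod ℓ) r
        = (x : R → ZMod ℓ) (σ.symm r) := rfl
    have := congrFun hc (σ.symm r)
    simpa [hval] using this)

/-- **(Klemm; Remark 4.1)** If `ℓ` is an odd prime not dividing `n = #R ≥ 4` and
`G ≤ Perm(R)` acts doubly transitively on `R`, then the centralizer of `G` in
`End_{F_ℓ}((F_ℓ^R)^{00})`, where the heart `(F_ℓ^R)^{00} = (F_ℓ^R)^0`, consists exactly
of the scalar operators `F_ℓ`. -/
theorem centralizer_eq_scalars_of_doubly_transitive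
    (ℓ : ℕ) (hℓ : ℓ.Prime) (hodd : Odd ℓ)
    (R : Type*) [Fintype R] (hn : 4 ≤ Fintype.card R)
    (hdvd : ¬ (ℓ ∣ Fintype.card R))
    (G : Subgroup (Equiv.Perm R))
    (h2t : ∀ a b c d : R, a ≠ b → c ≠ d → ∃ σ ∈ G, σ a = c ∧ σ b = d) :
    {u : Module.End (ZMod ℓ) (zeroSum ℓ R) | ∀ σ ∈ G, Commute u (permSub σ)}
      = Set.range fun c : ZMod ℓ =>
          (c • (1 : Module.End (ZMod ℓ) (zeroSum ℓ R))) := by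
  classical
  haveI : Fact ℓ.Prime := ⟨hℓ⟩
  have hN : ((Fintype.card R : ℕ) : ZMod ℓ) ≠ 0 := by
    intro h
    exact hdvd ((ZMod.natCast_eq_zero_iff _ _).1 h)
  ext u
  simp only [Set.mem_setOf_eq, Set.mem_range]
  constructor
  swap
  · rintro ⟨c, rfl⟩ σ _
    exact (Commute.one_left _).smul_left c
  intro hu
  -- the vectors `n δ_r - 1`
  have hemem : ∀ r : R, (fun s : R => ((Fintype.card R : ℕ) : ZMod ℓ) *
      (if s = r then 1 else 0) - 1) ∈ zeroSum ℓ R := by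
    intro r
    rw [mem_zeroSum]
    simp [Finset.sum_sub_distrib]
  let e : R → zeroSum ℓ R := fun r => ⟨_, hemem r⟩
  have he : ∀ r s, (e r : R → ZMod ℓ) s =
      ((Fintype.card R : ℕ) : ZMod ℓ) * (if s = r then 1 else 0) - 1 := fun _ _ => rfl
  have hperm : ∀ (σ : Equiv.Perm R) (x : zeroSum ℓ R) (s : R),
      (permSub σ x : R → ZMod ℓ) s = (x : R → ZMod ℓ) (σ.symm s) := fun _ _ _ => rfl
  have hpe : ∀ (σ : Equiv.Perm R) (r : R), permSub σ (e r) = e (σ r) := by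
    intro σ r
    apply Subtype.ext
    funext s
    rw [hperm, he, he]
    simp only [Equiv.symm_apply_eq]
  have hK : ∀ σ ∈ G, ∀ r s, (u (e (σ r)) : R → ZMod ℓ) (σ s) = (u (e r) : R → ZMod ℓ) s := by
    intro σ hσ r s
    have h1 : u (permSub σ (e r)) = permSub σ (u (e r)) :=
      LinearMap.congr_fun (hu σ hσ) (e r)
    rw [← hpe, h1, hperm, Equiv.symm_apply_apply]
  obtain ⟨p, q, hpq⟩ : ∃ p q : R, p ≠ q :=
    Fintype.exists_pair_of_one_lt_card (by omega)
  have hb : ∀ r s, r ≠ s → (u (e r) : R → ZMod ℓ) s = (u (e p) : R → ZMod ℓ) q := by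
    intro r s hrs
    obtain ⟨σ, hσ, h1, h2⟩ := h2t p q r s hpq hrs
    rw [← h1, ← h2, hK σ hσ]
  generalize (u (e p) : R → ZMod ℓ) q = b at hb
  have hue : ∀ r, u (e r) = (-b) • e r := by
    intro r
    have hsum : ∑ s, (u (e r) : R → ZMod ℓ) s = 0 := (u (e r)).2
    have hd : ∀ s, (u (e r) : R → ZMod ℓ) s =
        ((u (e r) : R → ZMod ℓ) r - b) * (if s = r then 1 else 0) + b := by
      intro s
      by_cases h : s = r
      · subst h; simp
      · rw [hb r s (Ne.symm h)]; simp [h]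
    have h3 : (u (e r) : R → ZMod ℓ) r - b + ((Fintype.card R : ℕ) : ZMod ℓ) * b = 0 := by
      rw [Finset.sum_congr rfl (fun s _ => hd s)] at hsum
      simpa [Finset.sum_add_distrib] using hsum
    apply Subtype.ext
    funext s
    rw [hd s, Submodule.coe_smul, Pi.smul_apply, he, smul_eq_mul]
    linear_combination (if s = r then 1 else 0) * h3
  have hdec : ∀ x : zeroSum ℓ R, ((Fintype.card R : ℕ) : ZMod ℓ) • x =
      ∑ r, (x : R → ZMod ℓ) r • e r := by
    intro x
    have hx : ∑ s, (x : R → ZMod ℓ) s = 0 := x.2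
    apply Subtype.ext
    funext s
    simp [Finset.sum_apply, he, mul_sub, Finset.sum_sub_distrib, hx]
    ring
  refine ⟨-b, ?_⟩
  ext1 x
  apply smul_right_injective _ hN
  change ((Fintype.card R : ℕ) : ZMod ℓ) • ((-b) • x) = ((Fintype.card R : ℕ) : ZMod ℓ) • u x
  rw [← map_smul, hdec x, map_sum, smul_comm, hdec x, Finset.smul_sum]
  refine Finset.sum_congr rfl fun r _ => ?_
  rw [map_smul, hue, smul_comm]
end

section
/- Let ℓ be an odd prime and R a finite set of cardinality n ≥ 4 with ℓ dividing n. Let G ≤ Perm(R) be a permutation group acting 3-transitively on R. Then the centralizer of G in End_{F_ℓ}((F_ℓ^R)^{00}) consists exactly of the scalar operators; that is, End_G((F_ℓ^R)^{00}) = F_ℓ. -/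
open Finset

open Classical in
/-- The difference of two indicator functions, as an element of the zero-sum hyperplane. -/
noncomputable def diffVec (ℓ : ℕ) {R : Type*} [Fintype R] (r s : R) : zeroSum ℓ R :=
  ⟨Pi.single r 1 - Pi.single s 1, by
    rw [mem_zeroSum]
    simp [Finset.sum_sub_distrib, Pi.single_apply]⟩

open Classical in
theorem diffVec_apply (ℓ : ℕ) {R : Type*} [Fintype R] (r s t : R) :
    (diffVec ℓ r s : R → ZMod ℓ) t = (if t = r then 1 else 0) - (if t = s then 1 else 0) := by
  simp [diffVec, Pi.single_apply]

theorem permSub_val {ℓ : ℕ} {R : Type*} [Fintype R] (σ : Equiv.Perm R) (x : zeroSum ℓ R) (t : R) :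
    (permSub σ x : R → ZMod ℓ) t = (x : R → ZMod ℓ) (σ.symm t) := rfl

theorem permSub_diffVec {ℓ : ℕ} {R : Type*} [Fintype R] (σ : Equiv.Perm R) (r s : R) :
    permSub σ (diffVec ℓ r s) = diffVec ℓ (σ r) (σ s) := by
  ext t
  rw [permSub_val, diffVec_apply, diffVec_apply]
  have h : ∀ w, (σ.symm t = w) = (t = σ w) := fun w => propext (Equiv.symm_apply_eq σ)
  congr 1
  · by_cases hw : t = σ r
    · rw [if_pos hw, if_pos ((h r).mpr hw)]
    · rw [if_neg hw, if_neg (fun h' => hw ((h r).mp h'))]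
  · by_cases hw : t = σ s
    · rw [if_pos hw, if_pos ((h s).mpr hw)]
    · rw [if_neg hw, if_neg (fun h' => hw ((h s).mp h'))]

theorem permHeart_mk {ℓ : ℕ} {R : Type*} [Fintype R] (σ : Equiv.Perm R) (x : zeroSum ℓ R) :
    permHeart σ ((constInZeroSum ℓ R).mkQ x) = (constInZeroSum ℓ R).mkQ (permSub σ x) := rfl

theorem mem_constInZeroSum {ℓ : ℕ} {R : Type*} [Fintype R] (x : zeroSum ℓ R) :
    x ∈ constInZeroSum ℓ R ↔ ∃ c : ZMod ℓ, ∀ t, (x : R → ZMod ℓ) t = c := by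
  simp only [constInZeroSum, Submodule.mem_comap, Submodule.subtype_apply,
      constLine, Submodule.mem_span_singleton]
  constructor
  · rintro ⟨c, hc⟩
    exact ⟨c, fun t => by simpa using (congrFun hc t).symm⟩
  · rintro ⟨c, hc⟩
    exact ⟨c, by funext t; simp [hc t]⟩

theorem eq_sum_diffVec {ℓ : ℕ} {R : Type*} [Fintype R] (a : R) (x : zeroSum ℓ R) :
    x = ∑ r, (x : R → ZMod ℓ) r • diffVec ℓ r a := by
  classical
  have hx := (mem_zeroSum ℓ R _).1 x.2
  ext t
  rw [Submodule.coe_sum, Finset.sum_apply]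
  simp only [Submodule.coe_smul, Pi.smul_apply, diffVec_apply, smul_eq_mul, mul_sub,
    Finset.sum_sub_distrib, ← Finset.sum_mul, hx]
  simp

/-- **(Klemm; Remark 4.1)** If `ℓ` is an odd prime dividing `n = #R ≥ 4` and
`G ≤ Perm(R)` acts 3-transitively on `R`, then the centralizer of `G` in
`End_{F_ℓ}((F_ℓ^R)^{00})`, where the heart `(F_ℓ^R)^{00} = (F_ℓ^R)^0/(F_ℓ·1)`, consists
exactly of the scalar operators `F_ℓ`. -/
theorem centralizer_eq_scalars_of_three_transitive
    (ℓ : ℕ) (hℓ : ℓ.Prime) (hodd : Odd ℓ)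
    (R : Type*) [Fintype R] (hn : 4 ≤ Fintype.card R)
    (hdvd : ℓ ∣ Fintype.card R)
    (G : Subgroup (Equiv.Perm R))
    (h3t : ∀ a₁ a₂ a₃ b₁ b₂ b₃ : R, a₁ ≠ a₂ → a₁ ≠ a₃ → a₂ ≠ a₃ →
      b₁ ≠ b₂ → b₁ ≠ b₃ → b₂ ≠ b₃ →
      ∃ σ ∈ G, σ a₁ = b₁ ∧ σ a₂ = b₂ ∧ σ a₃ = b₃) :
    {u : Module.End (ZMod ℓ) (zeroSum ℓ R ⧸ constInZeroSum ℓ R) |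
        ∀ σ ∈ G, Commute u (permHeart σ)}
      = Set.range fun c : ZMod ℓ =>
          (c • (1 : Module.End (ZMod ℓ) (zeroSum ℓ R ⧸ constInZeroSum ℓ R))) := by
  classical
  have third : ∀ a b : R, ∃ c, a ≠ c ∧ b ≠ c := by
    intro a b
    obtain ⟨c, -, hc⟩ := Finset.exists_mem_notMem_of_card_lt_card
      (s := ({a, b} : Finset R)) (t := Finset.univ)
      (lt_of_le_of_lt Finset.card_le_two (by rw [Finset.card_univ]; omega))
    simp only [Finset.mem_insert, Finset.mem_singleton, not_or] at hc
    exact ⟨c, Ne.symm hc.1, Ne.symm hc.2⟩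
  have hcard : (Fintype.card R : ZMod ℓ) = 0 := (ZMod.natCast_eq_zero_iff _ _).2 hdvd
  ext u
  simp only [Set.mem_setOf_eq, Set.mem_range]
  constructor
  · intro hu
    have hu' : ∀ σ ∈ G, ∀ y, u (permHeart σ y) = permHeart σ (u y) := fun σ hσ y =>
      LinearMap.congr_fun (hu σ hσ).eq y
    obtain ⟨a⟩ : Nonempty R := Fintype.card_pos_iff.1 (by omega)
    obtain ⟨b, hab, -⟩ := third a a
    obtain ⟨d, had, hbd⟩ := third a b
    obtain ⟨f, hf⟩ := (constInZeroSum ℓ R).mkQ_surjective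
      (u ((constInZeroSum ℓ R).mkQ (diffVec ℓ b a)))
    -- `f` is constant outside `{a, b}`
    have hconst : ∀ t, a ≠ t → b ≠ t → (f : R → ZMod ℓ) t = (f : R → ZMod ℓ) d := by
      intro t hat hbt
      obtain ⟨σ, hσ, h1, h2, h3⟩ := h3t a b d a b t hab had hbd hab hat hbt
      have h := hu' σ hσ ((constInZeroSum ℓ R).mkQ (diffVec ℓ b a))
      rw [permHeart_mk, permSub_diffVec, h1, h2, ← hf, permHeart_mk, ← sub_eq_zero, ← map_sub,
        Submodule.mkQ_apply, Submodule.Quotient.mk_eq_zero, mem_constInZeroSum] at h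
      obtain ⟨c, hc⟩ := h
      have ha := hc a
      have ht := hc t
      simp only [Submodule.coe_sub, Pi.sub_apply, permSub_val] at ha ht
      rw [(Equiv.symm_apply_eq σ).2 h1.symm, sub_self] at ha
      rw [(Equiv.symm_apply_eq σ).2 h3.symm, ← ha, sub_eq_zero] at ht
      exact ht
    set k := (f : R → ZMod ℓ) d with hk
    set c := (f : R → ZMod ℓ) b - k with hc
    have hsum := (mem_zeroSum ℓ R _).1 f.2
    have hfa : (f : R → ZMod ℓ) a - k = -c := by
      have h0 : ∑ r, ((f : R → ZMod ℓ) r - k) = 0 := by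
        rw [Finset.sum_sub_distrib, hsum]
        simp [hcard]
      rw [Fintype.sum_eq_add a b hab (by
        rintro x ⟨hxa, hxb⟩
        rw [hconst x hxa.symm hxb.symm, sub_self])] at h0
      rw [hc]
      exact eq_neg_of_add_eq_zero_left h0
    have key : u ((constInZeroSum ℓ R).mkQ (diffVec ℓ b a))
        = c • (constInZeroSum ℓ R).mkQ (diffVec ℓ b a) := by
      rw [← hf, ← map_smul, ← sub_eq_zero, ← map_sub,
        Submodule.mkQ_apply, Submodule.Quotient.mk_eq_zero, mem_constInZeroSum]
      refine ⟨k, fun t => ?_⟩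
      simp only [Submodule.coe_sub, Pi.sub_apply, Submodule.coe_smul, Pi.smul_apply,
        diffVec_apply, smul_eq_mul]
      by_cases hta : t = a
      · subst hta
        simp only [if_neg hab, if_true]
        linear_combination hfa
      · by_cases htb : t = b
        · subst htb
          simp only [if_neg hta, if_true]
          linear_combination -hc
        · simp only [if_neg hta, if_neg htb]
          rw [hconst t (Ne.symm hta) (Ne.symm htb)]
          ring
    have key2 : ∀ r, u ((constInZeroSum ℓ R).mkQ (diffVec ℓ r a))
        = c • (constInZeroSum ℓ R).mkQ (diffVec ℓ r a) := by
      intro r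
      by_cases hra : r = a
      · subst hra
        have : diffVec ℓ r r = 0 := by
          ext t
          simp [diffVec_apply]
        rw [this]
        simp
      · obtain ⟨e, hae, hre⟩ := third a r
        obtain ⟨σ, hσ, h1, h2, -⟩ := h3t a b d a r e hab had hbd (Ne.symm hra) hae hre
        have h := hu' σ hσ ((constInZeroSum ℓ R).mkQ (diffVec ℓ b a))
        rw [key, map_smul, permHeart_mk, permSub_diffVec, h1, h2] at h
        exact h
    refine ⟨c, ?_⟩
    refine LinearMap.ext fun y => ?_
    obtain ⟨x, rfl⟩ := (constInZeroSum ℓ R).mkQ_surjective y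
    rw [eq_sum_diffVec a x]
    simp only [map_sum, map_smul, key2, LinearMap.smul_apply, Module.End.one_apply]
  · rintro ⟨c, rfl⟩ σ -
    exact (Commute.one_left _).smul_left c
end

section
/- Let ℓ be an odd prime and R a finite set of cardinality n ≥ 4 with ℓ not dividing n. Let H ≤ Perm(R) be a permutation group such that every F_ℓ-linear endomorphism of (F_ℓ^R)^{00} commuting with the action of H is a scalar, i.e., End_H((F_ℓ^R)^{00}) = F_ℓ. Then H acts doubly transitively on R. -/
open Finset

/-- An `H`-invariant matrix with zero column sums acts as a scalar on the heart. -/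
theorem scalar_of_invariant_aux {ℓ : ℕ} {R : Type*} [Fintype R] [DecidableEq R]
    (H : Subgroup (Equiv.Perm R))
    (hcent : ∀ u : Module.End (ZMod ℓ) (zeroSum ℓ R),
      (∀ σ ∈ H, Commute u (permSub σ)) →
        ∃ c : ZMod ℓ, u = c • (1 : Module.End (ZMod ℓ) (zeroSum ℓ R)))
    (M : R → R → ZMod ℓ) (hM : ∀ σ ∈ H, ∀ r s, M (σ r) (σ s) = M r s)
    (hcol : ∀ s, ∑ r, M r s = 0) :
    ∃ c : ZMod ℓ, ∀ r s t, M r s - M r t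
      = c * ((if r = s then 1 else 0) - (if r = t then 1 else 0)) := by
  have hres : ∀ ψ ∈ zeroSum ℓ R, (Matrix.mulVecLin (Matrix.of M)) ψ ∈ zeroSum ℓ R := by
    intro ψ _
    rw [mem_zeroSum]
    simp only [Matrix.mulVecLin_apply, Matrix.mulVec, dotProduct, Matrix.of_apply]
    rw [Finset.sum_comm]
    simp [← Finset.sum_mul, hcol]
  obtain ⟨c, hc⟩ := hcent ((Matrix.mulVecLin (Matrix.of M)).restrict hres) (by
    intro σ hσ
    refine LinearMap.ext fun ψ => Subtype.ext (funext fun r => ?_)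
    change ∑ s, M r s * (ψ : R → ZMod ℓ) (σ.symm s)
      = ∑ s, M (σ.symm r) s * (ψ : R → ZMod ℓ) s
    rw [← Equiv.sum_comp σ]
    refine Finset.sum_congr rfl fun s _ => ?_
    have := hM σ hσ (σ.symm r) s
    rw [Equiv.apply_symm_apply] at this
    rw [this, Equiv.symm_apply_apply])
  refine ⟨c, fun r s t => ?_⟩
  have hψ : (Pi.single s 1 - Pi.single t 1 : R → ZMod ℓ) ∈ zeroSum ℓ R := by
    rw [mem_zeroSum]
    simp [Finset.sum_sub_distrib]
  have h := congrArg (fun φ : zeroSum ℓ R => (φ : R → ZMod ℓ) r) (LinearMap.congr_fun hc ⟨_, hψ⟩)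
  change (Matrix.of M).mulVec (Pi.single s 1 - Pi.single t 1) r
    = c * (Pi.single s 1 - Pi.single t 1 : R → ZMod ℓ) r at h
  rw [Matrix.mulVec_sub] at h
  simpa [Pi.single_apply] using h

/-- Four-point relation for an arbitrary `H`-invariant kernel. -/
theorem four_point_aux {ℓ : ℕ} [Fact ℓ.Prime] {R : Type*} [Fintype R] [DecidableEq R]
    (hn : (Fintype.card R : ZMod ℓ) ≠ 0)
    (H : Subgroup (Equiv.Perm R))
    (hcent : ∀ u : Module.End (ZMod ℓ) (zeroSum ℓ R),
      (∀ σ ∈ H, Commute u (permSub σ)) →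
        ∃ c : ZMod ℓ, u = c • (1 : Module.End (ZMod ℓ) (zeroSum ℓ R)))
    (K : R → R → ZMod ℓ) (hK : ∀ σ ∈ H, ∀ r s, K (σ r) (σ s) = K r s) :
    ∃ c : ZMod ℓ, ∀ r q s t, K r s - K r t - K q s + K q t
      = c * ((if r = s then 1 else 0) - (if r = t then 1 else 0)
          - (if q = s then 1 else 0) + (if q = t then 1 else 0)) := by
  obtain ⟨c, hc⟩ := scalar_of_invariant_aux H hcent
    (fun r s => K r s - (Fintype.card R : ZMod ℓ)⁻¹ * ∑ q, K q s)
    (by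
      intro σ hσ r s
      have : ∑ q, K q (σ s) = ∑ q, K q s := by
        rw [← Equiv.sum_comp σ]
        exact Finset.sum_congr rfl fun q _ => hK σ hσ q s
      simp only [this, hK σ hσ])
    (by
      intro s
      rw [Finset.sum_sub_distrib, Finset.sum_const, Finset.card_univ, nsmul_eq_mul,
        mul_inv_cancel_left₀ hn, sub_self])
  refine ⟨c, fun r q s t => ?_⟩
  linear_combination hc r s t - hc q s t

/-- **(Klemm, converse)** Let `ℓ` be an odd prime not dividing `n = #R ≥ 4`, and let
`H ≤ Perm(R)` be such that every `F_ℓ`-linear endomorphism of the heart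
`(F_ℓ^R)^{00} = (F_ℓ^R)^0` commuting with the action of `H` is a scalar.  Then `H`
acts doubly transitively on `R`. -/
theorem doubly_transitive_of_centralizer_eq_scalars
    (ℓ : ℕ) (hℓ : ℓ.Prime) (hodd : Odd ℓ)
    (R : Type*) [Fintype R] (hn : 4 ≤ Fintype.card R)
    (hdvd : ¬ (ℓ ∣ Fintype.card R))
    (H : Subgroup (Equiv.Perm R))
    (hcent : ∀ u : Module.End (ZMod ℓ) (zeroSum ℓ R),
      (∀ σ ∈ H, Commute u (permSub σ)) →
        ∃ c : ZMod ℓ, u = c • (1 : Module.End (ZMod ℓ) (zeroSum ℓ R))) :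
    ∀ a b c d : R, a ≠ b → c ≠ d → ∃ σ ∈ H, σ a = c ∧ σ b = d := by
  classical
  haveI : Fact ℓ.Prime := ⟨hℓ⟩
  have hn0 : (Fintype.card R : ZMod ℓ) ≠ 0 := by
    rwa [Ne, ZMod.natCast_eq_zero_iff]
  have key := four_point_aux hn0 H hcent
  -- transitivity
  have htrans : ∀ x y : R, ∃ σ ∈ H, σ x = y := by
    intro x y
    by_contra hxy
    let O : R → Prop := fun z => ∃ σ ∈ H, σ x = z
    have hO : ∀ σ ∈ H, ∀ z, O (σ z) ↔ O z := by
      intro σ hσ z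
      constructor
      · rintro ⟨τ, hτ, h⟩
        exact ⟨σ⁻¹ * τ, H.mul_mem (H.inv_mem hσ) hτ, by simp [h]⟩
      · rintro ⟨τ, hτ, h⟩
        exact ⟨σ * τ, H.mul_mem hσ hτ, by simp [h]⟩
    have hx : O x := ⟨1, H.one_mem, rfl⟩
    have hy : ¬ O y := hxy
    have hne : x ≠ y := fun h => hy (h ▸ hx)
    obtain ⟨c, hc⟩ := key (fun r s => if O r ∧ O s then 1 else 0) (by
      intro σ hσ r s
      simp only [hO σ hσ])
    obtain ⟨z, hzx, hzy⟩ : ∃ z, z ≠ x ∧ z ≠ y := by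
      have hlt : ({x, y} : Finset R).card < Fintype.card R :=
        lt_of_le_of_lt Finset.card_le_two (by omega)
      obtain ⟨z, hz⟩ := Finset.exists_mem_notMem_of_card_lt_card
        (s := ({x, y} : Finset R)) (t := Finset.univ) (by simpa using hlt)
      exact ⟨z, by simpa using hz.2⟩
    have h1 : (1 : ZMod ℓ) = c * 2 := by
      have := hc x y x y
      simp [hx, hy, hne, hne.symm] at this
      rw [this]; ring
    have h2 : (1 : ZMod ℓ) = c := by
      by_cases hz : O z
      · have := hc z y x y
        simpa [hx, hy, hz, hne, hne.symm, hzx, hzy] using this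
      · have := hc x z x y
        simpa [hx, hy, hz, hne, hne.symm, hzx, hzy] using this
    rw [← h2] at h1
    exact one_ne_zero (α := ZMod ℓ) (by linear_combination -h1)
  intro a b c d hab hcd
  by_contra hno
  let O : R → R → Prop := fun r s => ∃ σ ∈ H, σ a = r ∧ σ b = s
  have hO : ∀ σ ∈ H, ∀ r s, O (σ r) (σ s) ↔ O r s := by
    intro σ hσ r s
    constructor
    · rintro ⟨τ, hτ, h, h'⟩
      exact ⟨σ⁻¹ * τ, H.mul_mem (H.inv_mem hσ) hτ, by simp [h], by simp [h']⟩
    · rintro ⟨τ, hτ, h, h'⟩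
      exact ⟨σ * τ, H.mul_mem hσ hτ, by simp [h], by simp [h']⟩
  have hOab : O a b := ⟨1, H.one_mem, rfl, rfl⟩
  have hOcd : ¬ O c d := hno
  obtain ⟨K, hKdef⟩ : ∃ K : R → R → ZMod ℓ, K = fun r s => if O r s then 1 else 0 := ⟨_, rfl⟩
  have hK : ∀ σ ∈ H, ∀ r s, K (σ r) (σ s) = K r s := by
    intro σ hσ r s
    simp only [hKdef, hO σ hσ]
  have hKab : K a b = 1 := by simp [hKdef, hOab]
  have hKcd : K c d = 0 := by simp [hKdef, hOcd]
  obtain ⟨e, he⟩ := key K hK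
  have hrow : ∀ r q, ∑ t, K r t = ∑ t, K q t := by
    intro r q
    obtain ⟨σ, hσ, rfl⟩ := htrans r q
    rw [← Equiv.sum_comp σ (fun t => K (σ r) t)]
    exact Finset.sum_congr rfl fun t _ => (hK σ hσ r t).symm
  have h1 : ∀ r q s, K r s - K q s
      = e * ((if r = s then 1 else 0) - (if q = s then 1 else 0)) := by
    intro r q s
    have h := Finset.sum_congr (rfl : (Finset.univ : Finset R) = _) fun t _ => he r q s t
    rw [← Finset.mul_sum] at h
    simp only [Finset.sum_add_distrib, Finset.sum_sub_distrib, Finset.sum_const,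
      Finset.card_univ, nsmul_eq_mul, Finset.sum_ite_eq, Finset.mem_univ, if_true] at h
    apply mul_left_cancel₀ hn0
    linear_combination h + hrow r q
  have h2 : ∀ r s t, K r s - K r t
      = e * ((if r = s then 1 else 0) - (if r = t then 1 else 0)) := by
    intro r s t
    have hcol : ∑ q, K q s = ∑ q, K q t := by
      obtain ⟨σ, hσ, rfl⟩ := htrans s t
      rw [← Equiv.sum_comp σ (fun q => K q (σ s))]
      exact Finset.sum_congr rfl fun q _ => (hK σ hσ q s).symm
    have h := Finset.sum_congr (rfl : (Finset.univ : Finset R) = _) fun q _ => he r q s t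
    rw [← Finset.mul_sum] at h
    simp only [Finset.sum_add_distrib, Finset.sum_sub_distrib, Finset.sum_const,
      Finset.card_univ, nsmul_eq_mul, Finset.sum_ite_eq', Finset.mem_univ, if_true] at h
    apply mul_left_cancel₀ hn0
    linear_combination h + hcol
  have h3 := h1 a c b
  have h4 := h2 c b d
  rw [if_neg hab] at h3
  rw [if_neg hcd] at h4
  exact one_ne_zero (α := ZMod ℓ) (by linear_combination h3 + h4 - hKab + hKcd)
end
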